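/- Let (xₙ)_{n≥1} be a real sequence and (Lₘ)_{m≥1} a sequence of pairwise distinct real numbers with i(xₙ;Lₘ) = αₘ for every m ≥ 1, where each αₘ ≥ 0. Then 0 ≤ Σ_{k=1}^∞ α_k ≤ 1. -/

import Mathlib

open Filter Topology MeasureTheory
open scoped Pointwise

/-- Lower (asymptotic) density of a set of naturals:
`liminf_n |K ∩ {1,…,n}|/n`. -/
noncomputable def lowerDensity (K : Set ℕ) : ℝ :=
  Filter.liminf (fun n : ℕ => (Nat.card ↥(K ∩ Set.Icc 1 n) : ℝ) / n) Filter.atTop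

/-- Upper (asymptotic) density of a set of naturals:
`limsup_n |K ∩ {1,…,n}|/n`. -/
noncomputable def upperDensity (K : Set ℕ) : ℝ :=
  Filter.limsup (fun n : ℕ => (Nat.card ↥(K ∩ Set.Icc 1 n) : ℝ) / n) Filter.atTop

/-- Index of convergence of a real sequence to a real number `L`:
`i(xₙ;L) = 1 - sup_{ε>0} δ₊({n : |xₙ - L| ≥ ε})`. -/
noncomputable def convIndex (x : ℕ → ℝ) (L : ℝ) : ℝ :=
  1 - ⨆ ε : {e : ℝ // 0 < e}, upperDensity {n | ε.1 ≤ |x n - L|}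

lemma card_inter_Icc_div_mem_Icc (K : Set ℕ) (n : ℕ) :
    (Nat.card ↥(K ∩ Set.Icc 1 n) : ℝ) / n ∈ Set.Icc (0 : ℝ) 1 := by
  refine ⟨by positivity, div_le_one_of_le₀ ?_ (by positivity)⟩
  have h := Set.ncard_le_ncard (Set.inter_subset_right (s := K)) (Set.finite_Icc 1 n)
  rw [← Nat.card_coe_set_eq, ← Nat.card_coe_set_eq (Set.Icc 1 n)] at h
  exact_mod_cast h.trans (by simp)

lemma isBoundedUnder_card_inter_Icc_div (K : Set ℕ) :
    IsBoundedUnder (· ≤ ·) atTop (fun n : ℕ => (Nat.card ↥(K ∩ Set.Icc 1 n) : ℝ) / n) :=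
  isBoundedUnder_of ⟨1, fun n => (card_inter_Icc_div_mem_Icc K n).2⟩

lemma upperDensity_le_one (K : Set ℕ) : upperDensity K ≤ 1 :=
  limsup_le_of_le (isCoboundedUnder_le_of_le atTop fun n => (card_inter_Icc_div_mem_Icc K n).1)
    (Eventually.of_forall fun n => (card_inter_Icc_div_mem_Icc K n).2)

lemma upperDensity_le_one_sub_convIndex (x : ℕ → ℝ) (L : ℝ) {ε : ℝ} (hε : 0 < ε) :
    upperDensity {n | ε ≤ |x n - L|} ≤ 1 - convIndex x L := by
  have hb : BddAbove (Set.range fun ε : {e : ℝ // 0 < e} =>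
      upperDensity {n | ε.1 ≤ |x n - L|}) :=
    ⟨1, by rintro _ ⟨e, rfl⟩; exact upperDensity_le_one _⟩
  simpa [convIndex] using le_ciSup hb ⟨ε, hε⟩

lemma card_inter_Icc_add_card_compl_inter_Icc (K : Set ℕ) (n : ℕ) :
    Nat.card ↥(K ∩ Set.Icc 1 n) + Nat.card ↥(Kᶜ ∩ Set.Icc 1 n) = n := by
  have h := Set.ncard_inter_add_ncard_sdiff_eq_ncard (Set.Icc 1 n) K (Set.finite_Icc 1 n)
  rw [Set.inter_comm, Set.sdiff_eq, Set.inter_comm _ Kᶜ, ← Nat.card_coe_set_eq,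
    ← Nat.card_coe_set_eq, ← Nat.card_coe_set_eq] at h
  simpa using h

lemma sum_card_inter_Icc_le {ι : Type*} (s : Finset ι) (A : ι → Set ℕ)
    (hA : (s : Set ι).PairwiseDisjoint A) (n : ℕ) :
    ∑ i ∈ s, Nat.card ↥(A i ∩ Set.Icc 1 n) ≤ n := by
  classical
  have hcard (i : ι) : Nat.card ↥(A i ∩ Set.Icc 1 n) =
      ((Finset.Icc 1 n).filter (· ∈ A i)).card := by
    rw [Nat.card_coe_set_eq, ← Set.ncard_coe_finset]
    congr 1
    ext k
    simp only [Set.mem_inter_iff, Set.mem_Icc, Finset.coe_filter, Finset.mem_Icc,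
      Set.mem_ofPred_eq, and_comm]
  simp_rw [hcard]
  rw [← Finset.card_biUnion]
  · refine (Finset.card_le_card (t := Finset.Icc 1 n) ?_).trans (by simp)
    exact Finset.biUnion_subset.2 fun i _ => Finset.filter_subset _ _
  · intro i hi j hj hij
    refine Finset.disjoint_filter.2 fun k _ hki hkj => ?_
    exact Set.disjoint_left.1 (hA hi hj hij) hki hkj

/-- A finite family of pairwise distinct reals is uniformly separated. -/
lemma exists_pos_two_mul_le_abs_sub {ι : Type*} (s : Finset ι) (L : ι → ℝ)
    (hL : Function.Injective L) :
    ∃ ε > 0, ∀ i ∈ s, ∀ j ∈ s, i ≠ j → 2 * ε ≤ |L i - L j| := by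
  have h : ∀ᶠ ε in 𝓝[>] (0 : ℝ), ∀ i ∈ s, ∀ j ∈ s, i ≠ j → 2 * ε ≤ |L i - L j| := by
    rw [Filter.eventually_all_finset]
    intro i _
    rw [Filter.eventually_all_finset]
    intro j _
    by_cases hij : i = j
    · simp [hij]
    have hpos : 0 < |L i - L j| / 2 := by
      have := abs_pos.2 (sub_ne_zero.2 (hL.ne hij))
      positivity
    filter_upwards [Ioo_mem_nhdsGT hpos] with ε hε _
    linarith [hε.2]
  obtain ⟨ε, hε, hpos⟩ := (h.and self_mem_nhdsWithin).exists
  exact ⟨ε, hpos, hε⟩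

lemma sum_convIndex_le_one {ι : Type*} (x : ℕ → ℝ) (L : ι → ℝ) (hL : Function.Injective L)
    (s : Finset ι) : ∑ i ∈ s, convIndex x (L i) ≤ 1 := by
  obtain ⟨ε, hε, hsep⟩ := exists_pos_two_mul_le_abs_sub s L hL
  let B : ι → Set ℕ := fun i => {n | ε ≤ |x n - L i|}
  have hdisj : (s : Set ι).PairwiseDisjoint fun i => (B i)ᶜ := by
    intro i hi j hj hij
    refine Set.disjoint_left.2 fun n hni hnj => ?_
    simp only [B, Set.mem_compl_iff, Set.mem_ofPred_eq, not_le] at hni hnj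
    have h := abs_sub_le (L i) (x n) (L j)
    rw [abs_sub_comm (L i) (x n)] at h
    linarith [hsep i hi j hj hij]
  have key (η : ℝ) (hη : 0 < η) : ∑ i ∈ s, (convIndex x (L i) - η) ≤ 1 := by
    have hev : ∀ᶠ n : ℕ in atTop, ∀ i ∈ s,
        (Nat.card ↥(B i ∩ Set.Icc 1 n) : ℝ) / n < 1 - convIndex x (L i) + η := by
      rw [Filter.eventually_all_finset]
      intro i _
      refine eventually_lt_of_limsup_lt ?_ (isBoundedUnder_card_inter_Icc_div (B i))
      exact (upperDensity_le_one_sub_convIndex x (L i) hε).trans_lt (by linarith)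
    obtain ⟨n, hn, hn1⟩ := (hev.and (eventually_gt_atTop 0)).exists
    have hn0 : (0 : ℝ) < n := by exact_mod_cast hn1
    calc ∑ i ∈ s, (convIndex x (L i) - η)
        ≤ ∑ i ∈ s, (Nat.card ↥((B i)ᶜ ∩ Set.Icc 1 n) : ℝ) / n := by
          refine Finset.sum_le_sum fun i hi => ?_
          have hsum : (Nat.card ↥(B i ∩ Set.Icc 1 n) : ℝ) / n
              + (Nat.card ↥((B i)ᶜ ∩ Set.Icc 1 n) : ℝ) / n = 1 := by
            rw [← add_div, div_eq_one_iff_eq hn0.ne']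
            exact_mod_cast card_inter_Icc_add_card_compl_inter_Icc (B i) n
          linarith [hn i hi]
      _ ≤ 1 := by
          rw [← Finset.sum_div]
          refine div_le_one_of_le₀ ?_ hn0.le
          exact_mod_cast sum_card_inter_Icc_le s _ hdisj n
  refine le_of_forall_pos_le_add fun δ hδ => ?_
  have h := key (δ / (s.card + 1)) (by positivity)
  rw [Finset.sum_sub_distrib, Finset.sum_const, nsmul_eq_mul] at h
  have : (s.card : ℝ) * (δ / (s.card + 1)) ≤ δ := by
    rw [mul_div_assoc', div_le_iff₀ (by positivity)]
    nlinarith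
  linarith

theorem tsum_convIndex_le_one (x : ℕ → ℝ) (L : ℕ → ℝ) (α : ℕ → ℝ)
    (hL : Function.Injective L) (hα : ∀ m, 0 ≤ α m)
    (h : ∀ m, convIndex x (L m) = α m) :
    0 ≤ ∑' k : ℕ, α k ∧ (∑' k : ℕ, α k) ≤ 1 := by
  refine ⟨tsum_nonneg hα, Real.tsum_le_of_sum_range_le hα fun n => ?_⟩
  simp_rw [← h]
  exact sum_convIndex_le_one x L hL (Finset.range n)
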